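/- Let p, m, n ∈ ℕ with p ≤ m ≤ n, let λ ∈ ℝ with λ > −1/2 and λ ≠ 0, and let x ∈ ℝ. Then the product of three Gegenbauer polynomials linearizes as C_p^λ(x)·C_m^λ(x)·C_n^λ(x) = Σ_{k=0}^{⌊(p+m+n)/2⌋} 𝖥^λ_{k,p,m,n}·C^λ_{p+m+n−2k}(x), where 𝖥^λ_{k,p,m,n} = 𝖣^λ_{k,p,m,n} if 0 ≤ k ≤ p−1 and 𝖥^λ_{k,p,m,n} = 𝖤^λ_{k,p,m,n} if p ≤ k ≤ ⌊(p+m+n)/2⌋. -/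

import Mathlib

open MeasureTheory

/-- Pochhammer symbol `(a)_j` for real `a` and natural `j`. -/
noncomputable def poch (a : ℝ) (j : ℕ) : ℝ := (ascPochhammer ℝ j).eval a

/-- Pochhammer symbol `(a)_j` for integer index, with the convention
`(a)_{-j} = 1/((a-1)(a-2)⋯(a-j))` for `j ≥ 1`. -/
noncomputable def pochZ (a : ℝ) (j : ℤ) : ℝ :=
  if 0 ≤ j then poch a j.toNat
  else (∏ i ∈ Finset.range (-j).toNat, (a - (i + 1)))⁻¹

/-- Factorial of an integer: `j!` for `j ≥ 0` and `0` for `j < 0`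
(encoding `1/(negative integer)! = 0` via Lean's division by zero). -/
noncomputable def ifact (j : ℤ) : ℝ := if 0 ≤ j then (j.toNat.factorial : ℝ) else 0

/-- Generalized hypergeometric sum `ᵣF_s(a; b; z)` (intended for terminating series,
where all terms beyond the termination index vanish). -/
noncomputable def hypSum (a b : List ℝ) (z : ℝ) : ℝ :=
  ∑' j : ℕ, ((a.map fun t => poch t j).prod /
    ((b.map fun t => poch t j).prod * (j.factorial : ℝ))) * z ^ j

/-- Gegenbauer polynomial `C_n^λ(x)`. -/
noncomputable def gegC (lam : ℝ) (n : ℕ) (x : ℝ) : ℝ :=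
  poch (2 * lam) n / n.factorial *
    ∑ j ∈ Finset.range (n + 1),
      poch (-(n : ℝ)) j * poch ((n : ℝ) + 2 * lam) j /
        (poch (lam + 1 / 2) j * j.factorial) * ((1 - x) / 2) ^ j

/-- The coefficient `𝖣^λ_{k,p,m,n}` in the linearization of a product of three
Gegenbauer polynomials. -/
noncomputable def gegD (lam : ℝ) (k p m n : ℤ) : ℝ :=
  (ifact (m + n) * pochZ lam m * pochZ lam n * (lam + (m : ℝ) + n + p - 2 * k) *
      ifact (m + n + p - 2 * k) * pochZ lam k * pochZ lam (p - k) * pochZ lam (m + n - k) *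
      pochZ (2 * lam) (m + n + p - k)) /
    (ifact m * ifact n * pochZ lam (m + n) * (lam + (m : ℝ) + n + p - k) * ifact k *
      ifact (p - k) * ifact (m + n - k) * pochZ lam (m + n + p - k) *
      pochZ (2 * lam) (m + n + p - 2 * k)) *
  hypSum
    [lam, lam + (p : ℝ) - k, -(k : ℝ), -(m : ℝ), -(n : ℝ), -(m : ℝ) - n + k,
      -lam - (m : ℝ) - n, -lam - (m : ℝ) - n - p + k,
      (-lam + 2 - (m : ℝ) - n) / 2, (-2 * lam + 1 - (m : ℝ) - n) / 2,
      (-2 * lam + 2 - (m : ℝ) - n) / 2]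
    [1 + (p : ℝ) - k, -lam + 1 - (k : ℝ), -lam + 1 - (m : ℝ), -lam + 1 - (n : ℝ),
      -lam + 1 - (m : ℝ) - n + k, -2 * lam + 1 - (m : ℝ) - n,
      -2 * lam + 1 - (m : ℝ) - n - p + k,
      (-lam - (m : ℝ) - n) / 2, (-(m : ℝ) - n) / 2, (1 - (m : ℝ) - n) / 2]
    1

/-- The coefficient `𝖤^λ_{k,p,m,n}` in the linearization of a product of three
Gegenbauer polynomials. -/
noncomputable def gegE (lam : ℝ) (k p m n : ℤ) : ℝ :=
  ((lam + (m : ℝ) + n + p - 2 * k) * ifact (m + n + 2 * p - 2 * k) * pochZ lam p *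
      pochZ lam (k - p) * pochZ lam (m + p - k) * pochZ lam (n + p - k) *
      pochZ lam (m + n + p - 2 * k) * pochZ (2 * lam) (m + n + p - k)) /
    ((lam + (m : ℝ) + n + p - k) * ifact p * ifact (k - p) * ifact (m + p - k) *
      ifact (n + p - k) * pochZ lam (m + n + p - k) * pochZ lam (m + n + 2 * p - 2 * k) *
      pochZ (2 * lam) (m + n + p - 2 * k)) *
  hypSum
    [lam, lam + (k : ℝ) - p, -(p : ℝ), -(m : ℝ) - p + k, -(n : ℝ) - p + k,
      -(m : ℝ) - n - p + 2 * k, -lam - (m : ℝ) - n - p + k, -lam - (m : ℝ) - n - 2 * p + 2 * k,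
      (-lam + 2 * (k : ℝ) - 2 * p - m - n + 2) / 2,
      (-2 * lam + 1 + 2 * (k : ℝ) - 2 * p - m - n) / 2,
      (-2 * lam + 2 + 2 * (k : ℝ) - 2 * p - m - n) / 2]
    [1 + (k : ℝ) - p, -lam + 1 - (p : ℝ), -lam + 1 - (m : ℝ) - p + k,
      -lam + 1 - (n : ℝ) - p + k, -lam + 1 - (m : ℝ) - n - p + 2 * k,
      -2 * lam + 1 - (m : ℝ) - n - p + k, -2 * lam + 1 - (m : ℝ) - n - 2 * p + 2 * k,
      (-lam + 2 * (k : ℝ) - 2 * p - m - n) / 2, (2 * (k : ℝ) - 2 * p - m - n) / 2,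
      (1 + 2 * (k : ℝ) - 2 * p - m - n) / 2]
    1

/-- The Gegenbauer linearization coefficient `𝖥^λ_{k,p,m,n}`:
`𝖣` for `0 ≤ k ≤ p-1`, `𝖤` for `p ≤ k ≤ ⌊(p+m+n)/2⌋`, and `0` otherwise. -/
noncomputable def gegF (lam : ℝ) (k p m n : ℤ) : ℝ :=
  if 0 ≤ k ∧ k ≤ p - 1 then gegD lam k p m n
  else if p ≤ k ∧ k ≤ (p + m + n).fdiv 2 then gegE lam k p m n
  else 0

theorem poch_zero (a : ℝ) : poch a 0 = 1 := by simp [poch]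

theorem poch_succ (a : ℝ) (n : ℕ) : poch a (n + 1) = poch a n * (a + n) := by
  simp [poch, ascPochhammer_succ_eval]

theorem poch_add (a : ℝ) (m n : ℕ) : poch a (m + n) = poch a m * poch (a + m) n := by
  induction n with
  | zero => simp [poch_zero]
  | succ n ih => rw [← add_assoc, poch_succ, poch_succ, ih]; push_cast; ring

theorem poch_succ_left (a : ℝ) (n : ℕ) : poch a (n + 1) = a * poch (a + 1) n := by
  rw [add_comm, poch_add, poch_succ, poch_zero]; simp

theorem poch_one (n : ℕ) : poch 1 n = n.factorial := by
  induction n with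
  | zero => simp [poch_zero]
  | succ n ih => rw [poch_succ, ih, Nat.factorial_succ]; push_cast; ring

theorem poch_ne_zero {a : ℝ} (h : -1 < a) (h0 : a ≠ 0) (n : ℕ) : poch a n ≠ 0 := by
  induction n with
  | zero => simp [poch_zero]
  | succ n ih =>
    rw [poch_succ]
    refine mul_ne_zero ih ?_
    rcases n with _ | n
    · simpa using h0
    · push_cast
      have : (0 : ℝ) ≤ n := Nat.cast_nonneg n
      linarith

theorem poch_neg_eq_zero {n j : ℕ} (h : n < j) : poch (-(n : ℝ)) j = 0 := by
  obtain ⟨i, rfl⟩ : ∃ i, j = n + 1 + i := ⟨j - (n + 1), by omega⟩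
  rw [poch_add, poch_succ]; simp

/-- Reversal of the Pochhammer symbol. -/
theorem poch_reverse (a : ℝ) {j N : ℕ} (h : j ≤ N) :
    poch (1 - a - N) j * poch a (N - j) = (-1) ^ j * poch a N := by
  induction j with
  | zero => simp [poch_zero]
  | succ j ih =>
    obtain ⟨i, rfl⟩ : ∃ i, N = i + (j + 1) := ⟨N - (j + 1), by omega⟩
    have e1 : i + (j + 1) - (j + 1) = i := by omega
    have e2 : i + (j + 1) - j = i + 1 := by omega
    have ih := ih (by omega)
    rw [e2, poch_succ a i] at ih
    rw [e1, poch_succ, pow_succ]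
    push_cast at ih ⊢
    linear_combination -ih

theorem poch_two_mul (b : ℝ) (j : ℕ) :
    poch b (2 * j) = 4 ^ j * (poch (b / 2) j * poch ((b + 1) / 2) j) := by
  induction j with
  | zero => simp [poch_zero]
  | succ j ih =>
    rw [show 2 * (j + 1) = 2 * j + 1 + 1 by ring, poch_succ, poch_succ, ih, poch_succ, poch_succ]
    push_cast
    ring

/-- The coefficient of `((1 - x) / 2) ^ j` in `C_n^λ(x)`. -/
noncomputable def gegCoeff (lam : ℝ) (n j : ℕ) : ℝ :=
  poch (2 * lam) (n + j) * poch (-(n : ℝ)) j / (n.factorial * (poch (lam + 1 / 2) j * j.factorial))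

theorem gegC_eq_sum (lam : ℝ) {n M : ℕ} (h : n < M) (x : ℝ) :
    gegC lam n x = ∑ j ∈ Finset.range M, gegCoeff lam n j * ((1 - x) / 2) ^ j := by
  rw [gegC, Finset.mul_sum]
  refine Finset.sum_subset_zero_on_sdiff (Finset.range_subset_range.2 h) ?_ ?_
  · intro j hj
    rw [Finset.mem_sdiff, Finset.mem_range, Finset.mem_range] at hj
    simp [gegCoeff, poch_neg_eq_zero (show n < j by omega)]
  · intro j _
    rw [gegCoeff, poch_add, add_comm (2 * lam)]
    ring

theorem gegCoeff_rec_zero (lam : ℝ) (n : ℕ) :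
    (n + 2) * gegCoeff lam (n + 2) 0 =
      2 * (n + 1 + lam) * gegCoeff lam (n + 1) 0 - (n + 2 * lam) * gegCoeff lam n 0 := by
  simp only [gegCoeff, add_zero, poch_zero, poch_succ, Nat.factorial_succ]
  have := n.factorial_ne_zero
  have : (n : ℝ) + 1 + 1 ≠ 0 := by positivity
  push_cast
  field_simp
  ring

theorem gegCoeff_rec_succ {lam : ℝ} (h1 : -(1 / 2) < lam) (n j : ℕ) :
    (n + 2) * gegCoeff lam (n + 2) (j + 1) =
      2 * (n + 1 + lam) * (gegCoeff lam (n + 1) (j + 1) - 2 * gegCoeff lam (n + 1) j) -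
        (n + 2 * lam) * gegCoeff lam n (j + 1) := by
  have hf : (n.factorial : ℝ) ≠ 0 := by positivity
  have hn : (n : ℝ) + 1 + 1 ≠ 0 := by positivity
  have hn' : (n : ℝ) + 1 ≠ 0 := by positivity
  obtain ⟨μ, rfl⟩ : ∃ μ, lam = μ - 1 / 2 := ⟨lam + 1 / 2, by ring⟩
  have hp : ∀ i, poch μ i ≠ 0 := poch_ne_zero (by linarith) (by linarith)
  have hj' : ∀ i : ℕ, μ + i ≠ 0 := fun i => by
    have : (0 : ℝ) ≤ i := Nat.cast_nonneg i
    linarith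
  have hμ : gegCoeff (μ - 1 / 2) = fun n j => poch (2 * μ - 1) (n + j) * poch (-(n : ℝ)) j /
      (n.factorial * (poch μ j * j.factorial)) := by
    ext n j
    rw [gegCoeff, sub_add_cancel, show 2 * (μ - 1 / 2) = 2 * μ - 1 by ring]
  rw [hμ]
  rcases j with _ | i
  · have := hj' 0
    simp only [zero_add, add_zero, poch_zero, poch_succ, Nat.factorial_succ,
      Nat.factorial_zero]
    push_cast at *
    simp only [add_zero] at *
    field_simp
    ring
  · have hi : (i : ℝ) + 1 + 1 ≠ 0 := by positivity
    have hi' : (i : ℝ) + 1 ≠ 0 := by positivity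
    have hif : (i.factorial : ℝ) ≠ 0 := by positivity
    have hA := hj' i
    have hB := hj' (i + 1)
    have hP := hp i
    have e1 : poch (-((n + 2 : ℕ) : ℝ)) (i + 1 + 1) = (n + 2) * (n + 1) * poch (-(n : ℝ)) i := by
      rw [poch_succ_left, poch_succ_left]
      push_cast
      rw [show -((n : ℝ) + 2) + 1 + 1 = -n by ring]
      ring
    have e2 : poch (-((n + 1 : ℕ) : ℝ)) (i + 1) = -(n + 1) * poch (-(n : ℝ)) i := by
      rw [poch_succ_left]
      push_cast
      rw [show -((n : ℝ) + 1) + 1 = -n by ring]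
    have e3 : poch (-((n + 1 : ℕ) : ℝ)) (i + 1 + 1) =
        -(n + 1) * poch (-(n : ℝ)) i * (-n + i) := by
      rw [poch_succ, e2]
      push_cast
      ring
    simp only [e1, e2, e3]
    rw [show n + 2 + (i + 1 + 1) = n + i + 2 + 1 + 1 by ring,
      show n + 1 + (i + 1 + 1) = n + i + 2 + 1 by ring,
      show n + 1 + (i + 1) = n + i + 2 by ring,
      show n + (i + 1 + 1) = n + i + 2 by ring]
    simp only [poch_succ _ (n + i + 2 + 1), poch_succ _ (n + i + 2), poch_succ _ (i + 1),
      poch_succ _ i, Nat.factorial_succ]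
    push_cast at *
    generalize poch μ i = P at *
    generalize poch (-(n : ℝ)) i = Q at *
    generalize poch (2 * μ - 1) (n + i + 2) = R at *
    field_simp
    ring

/-- The three-term recurrence of the Gegenbauer polynomials. -/
theorem gegC_rec {lam : ℝ} (h1 : -(1 / 2) < lam) (n : ℕ) (x : ℝ) :
    (n + 2) * gegC lam (n + 2) x =
      2 * (n + 1 + lam) * x * gegC lam (n + 1) x - (n + 2 * lam) * gegC lam n x := by
  rw [gegC_eq_sum lam (show n + 2 < n + 2 + 1 by omega),
    gegC_eq_sum lam (show n < n + 2 + 1 by omega)]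
  have key : x * gegC lam (n + 1) x =
      ∑ j ∈ Finset.range (n + 2), (gegCoeff lam (n + 1) (j + 1) - 2 * gegCoeff lam (n + 1) j) *
        ((1 - x) / 2) ^ (j + 1) + gegCoeff lam (n + 1) 0 := by
    have e1 := gegC_eq_sum lam (show n + 1 < n + 2 by omega) x
    have e2 := gegC_eq_sum lam (show n + 1 < n + 2 + 1 by omega) x
    rw [Finset.sum_range_succ'] at e2
    have e3 : 2 * ((1 - x) / 2) * gegC lam (n + 1) x =
        ∑ j ∈ Finset.range (n + 2), 2 * gegCoeff lam (n + 1) j * ((1 - x) / 2) ^ (j + 1) := by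
      rw [e1, Finset.mul_sum]
      exact Finset.sum_congr rfl fun j _ => by ring
    simp only [sub_mul, Finset.sum_sub_distrib]
    rw [← e3]
    linear_combination e2
  rw [mul_assoc _ x, key, Finset.sum_range_succ' _ (n + 2), Finset.sum_range_succ' _ (n + 2)]
  have : ∀ j ∈ Finset.range (n + 2),
      (n + 2) * (gegCoeff lam (n + 2) (j + 1) * ((1 - x) / 2) ^ (j + 1)) =
        2 * (n + 1 + lam) * ((gegCoeff lam (n + 1) (j + 1) - 2 * gegCoeff lam (n + 1) j) *
        ((1 - x) / 2) ^ (j + 1)) - (n + 2 * lam) * (gegCoeff lam n (j + 1) *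
        ((1 - x) / 2) ^ (j + 1)) := fun j _ => by
    linear_combination ((1 - x) / 2) ^ (j + 1) * gegCoeff_rec_succ h1 n j
  have := Finset.sum_congr rfl this
  rw [Finset.sum_sub_distrib, ← Finset.mul_sum, ← Finset.mul_sum, ← Finset.mul_sum] at this
  linear_combination this + gegCoeff_rec_zero lam n

theorem gegC_zero (lam x : ℝ) : gegC lam 0 x = 1 := by
  simp [gegC, poch_zero]

theorem gegC_one {lam : ℝ} (h1 : -(1 / 2) < lam) (x : ℝ) : gegC lam 1 x = 2 * lam * x := by
  obtain ⟨μ, rfl⟩ : ∃ μ, lam = μ - 1 / 2 := ⟨lam + 1 / 2, by ring⟩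
  have : μ ≠ 0 := by linarith
  rw [gegC, sub_add_cancel]
  simp only [Finset.sum_range_succ, Finset.range_zero, Finset.sum_empty, poch_zero,
    show ∀ a, poch a 1 = a from fun a => by simp [poch], Nat.factorial]
  push_cast
  field_simp
  ring

theorem mul_two_add_natCast_ne_zero {lam : ℝ} (h1 : -(1 / 2) < lam) (h2 : lam ≠ 0) (n : ℕ) :
    lam * 2 + n ≠ 0 := by
  rcases n with _ | n
  · simpa using h2
  · push_cast
    have : (0 : ℝ) ≤ n := Nat.cast_nonneg n
    linarith

theorem add_natCast_ne_zero {lam : ℝ} (h1 : -(1 / 2) < lam) (h2 : lam ≠ 0) (n : ℕ) :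
    lam + n ≠ 0 := by
  rcases n with _ | n
  · simpa using h2
  · push_cast
    have : (0 : ℝ) ≤ n := Nat.cast_nonneg n
    linarith

/-- `(λ)_n / n!`. -/
noncomputable def pochFact (lam : ℝ) (n : ℕ) : ℝ := poch lam n / n.factorial

/-- `n! / (2λ)_n`. -/
noncomputable def factPochTwo (lam : ℝ) (n : ℕ) : ℝ := n.factorial / poch (2 * lam) n

/-- `(λ)_n / (2λ)_n`. -/
noncomputable def pochRatio (lam : ℝ) (n : ℕ) : ℝ := poch lam n / poch (2 * lam) n

/-- The coefficient of `C_{r+s}^λ` in the expansion of `C_{j+r}^λ C_{j+s}^λ`. -/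
noncomputable def linCoeff (lam : ℝ) (j r s : ℕ) : ℝ :=
  (lam + (r + s : ℕ)) / (lam + (j + r + s : ℕ)) *
    (pochFact lam j * pochFact lam r * pochFact lam s * factPochTwo lam (r + s)) /
      pochRatio lam (j + r + s)

theorem pochFact_zero (lam : ℝ) : pochFact lam 0 = 1 := by simp [pochFact, poch_zero]

theorem pochFact_succ (lam : ℝ) (n : ℕ) :
    pochFact lam (n + 1) = pochFact lam n * (lam + n) / (n + 1) := by
  rw [pochFact, pochFact, poch_succ, Nat.factorial_succ]
  push_cast
  field_simp

theorem factPochTwo_succ (lam : ℝ) (n : ℕ) :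
    factPochTwo lam (n + 1) = factPochTwo lam n * (n + 1) / (2 * lam + n) := by
  rw [factPochTwo, factPochTwo, poch_succ, Nat.factorial_succ]
  push_cast
  field_simp

theorem pochRatio_succ (lam : ℝ) (n : ℕ) :
    pochRatio lam (n + 1) = pochRatio lam n * (lam + n) / (2 * lam + n) := by
  rw [pochRatio, pochRatio, poch_succ, poch_succ]
  field_simp

theorem poch_ne_zero_of_neg_half_lt {lam : ℝ} (h1 : -(1 / 2) < lam) (h2 : lam ≠ 0) (n : ℕ) :
    poch lam n ≠ 0 := poch_ne_zero (by linarith) h2 n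

theorem poch_two_mul_ne_zero {lam : ℝ} (h1 : -(1 / 2) < lam) (h2 : lam ≠ 0) (n : ℕ) :
    poch (2 * lam) n ≠ 0 := poch_ne_zero (by linarith) (by simpa using h2) n

theorem pochFact_ne_zero {lam : ℝ} (h1 : -(1 / 2) < lam) (h2 : lam ≠ 0) (n : ℕ) :
    pochFact lam n ≠ 0 :=
  div_ne_zero (poch_ne_zero_of_neg_half_lt h1 h2 n) (by positivity)

theorem factPochTwo_ne_zero {lam : ℝ} (h1 : -(1 / 2) < lam) (h2 : lam ≠ 0) (n : ℕ) :
    factPochTwo lam n ≠ 0 :=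
  div_ne_zero (by positivity) (poch_two_mul_ne_zero h1 h2 n)

theorem pochRatio_ne_zero {lam : ℝ} (h1 : -(1 / 2) < lam) (h2 : lam ≠ 0) (n : ℕ) :
    pochRatio lam n ≠ 0 :=
  div_ne_zero (poch_ne_zero_of_neg_half_lt h1 h2 n) (poch_two_mul_ne_zero h1 h2 n)

theorem pochRatio_eq {lam : ℝ} (h1 : -(1 / 2) < lam) (h2 : lam ≠ 0) (n : ℕ) :
    pochRatio lam n = pochFact lam n * factPochTwo lam n := by
  have := poch_two_mul_ne_zero h1 h2 n
  rw [pochRatio, pochFact, factPochTwo]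
  field_simp

theorem linCoeff_zero_zero {lam : ℝ} (h1 : -(1 / 2) < lam) (h2 : lam ≠ 0) (n : ℕ) :
    linCoeff lam 0 0 n = 1 := by
  have := add_natCast_ne_zero h1 h2 n
  have := pochFact_ne_zero h1 h2 n
  have := factPochTwo_ne_zero h1 h2 n
  simp only [linCoeff, pochFact_zero, zero_add, pochRatio_eq h1 h2]
  field_simp

set_option maxRecDepth 10000 in
theorem linCoeff_rec {lam : ℝ} (h1 : -(1 / 2) < lam) (h2 : lam ≠ 0) (j r s : ℕ) :
    (j + r + 2) * linCoeff lam (j + 1) (r + 1) s =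
      (j + r + 1 + lam) * ((r + s + 1) / (lam + (r + s : ℕ)) * linCoeff lam (j + 1) r s +
        (r + s + 1 + 2 * lam) / (lam + (r + s + 2 : ℕ)) * linCoeff lam j (r + 1) (s + 1)) -
      (j + r + 2 * lam) * linCoeff lam j r (s + 1) := by
  have hc := pochRatio_ne_zero h1 h2 (j + r + s + 1)
  have a1 := add_natCast_ne_zero h1 h2 (r + s)
  have a2 := add_natCast_ne_zero h1 h2 (r + s + 1)
  have a3 := add_natCast_ne_zero h1 h2 (r + s + 1 + 1)
  have a4 := add_natCast_ne_zero h1 h2 (j + r + s + 1)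
  have a5 := add_natCast_ne_zero h1 h2 (j + r + s + 1 + 1)
  have b1 := mul_two_add_natCast_ne_zero h1 h2 (r + s)
  have b2 := mul_two_add_natCast_ne_zero h1 h2 (r + s + 1)
  have b4 := mul_two_add_natCast_ne_zero h1 h2 (j + r + s + 1)
  simp only [linCoeff]
  rw [show r + s + 2 = r + s + 1 + 1 by ring,
    show j + 1 + (r + 1) + s = j + r + s + 1 + 1 by ring,
    show j + 1 + r + s = j + r + s + 1 by ring,
    show j + (r + 1) + (s + 1) = j + r + s + 1 + 1 by ring,
    show j + r + (s + 1) = j + r + s + 1 by ring,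
    show r + 1 + (s + 1) = r + s + 1 + 1 by ring,
    show r + 1 + s = r + s + 1 by ring,
    show r + (s + 1) = r + s + 1 by ring]
  simp only [pochFact_succ, factPochTwo_succ, pochRatio_succ _ (j + r + s + 1)]
  generalize pochRatio lam (j + r + s + 1) = C at *
  generalize factPochTwo lam (r + s) = F at *
  generalize pochFact lam j = A at *
  generalize pochFact lam r = B at *
  generalize pochFact lam s = D at *
  push_cast at *
  rw [mul_comm] at b1 b2 b4
  field_simp
  ring

theorem linCoeff_rec_zero {lam : ℝ} (h1 : -(1 / 2) < lam) (h2 : lam ≠ 0) (r s : ℕ) :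
    (r + 1) * linCoeff lam 0 (r + 1) s =
      (r + lam) * ((r + s + 1) / (lam + (r + s : ℕ)) * linCoeff lam 0 r s) := by
  have hc := pochRatio_ne_zero h1 h2 (r + s)
  have a1 := add_natCast_ne_zero h1 h2 (r + s)
  have a2 := add_natCast_ne_zero h1 h2 (r + s + 1)
  have b1 := mul_two_add_natCast_ne_zero h1 h2 (r + s)
  simp only [linCoeff, zero_add]
  rw [show r + 1 + s = r + s + 1 by ring]
  simp only [pochFact_succ, factPochTwo_succ, pochRatio_succ]
  generalize pochRatio lam (r + s) = C at *
  generalize factPochTwo lam (r + s) = F at *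
  push_cast at *
  field_simp
  ring

theorem linCoeff_rec_last {lam : ℝ} (h1 : -(1 / 2) < lam) (h2 : lam ≠ 0) (j s : ℕ) :
    (j + 1) * linCoeff lam (j + 1) 0 s =
      (j + lam) * ((s + 2 * lam) / (lam + (s + 1 : ℕ)) * linCoeff lam j 0 (s + 1)) := by
  have hc := pochRatio_ne_zero h1 h2 (j + s + 1)
  have a1 := add_natCast_ne_zero h1 h2 s
  have a2 := add_natCast_ne_zero h1 h2 (s + 1)
  have a4 := add_natCast_ne_zero h1 h2 (j + s + 1)
  have b1 := mul_two_add_natCast_ne_zero h1 h2 s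
  simp only [linCoeff, zero_add, add_zero]
  rw [show j + 1 + s = j + s + 1 by ring, show j + (s + 1) = j + s + 1 by ring]
  simp only [pochFact_succ, factPochTwo_succ]
  generalize pochRatio lam (j + s + 1) = C at *
  push_cast at *
  field_simp
  ring

theorem sum_range_three_term {u v w z Y : ℕ → ℝ} {m : ℕ} (h0 : z 0 = u 0)
    (hs : ∀ j ≤ m, z (j + 1) = u (j + 1) + v j - w j) (hl : z (m + 2) = v (m + 1)) :
    ∑ j ∈ Finset.range (m + 2 + 1), z j * Y j =
      ∑ j ∈ Finset.range (m + 1 + 1), (u j * Y j + v j * Y (j + 1)) -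
        ∑ j ∈ Finset.range (m + 1), w j * Y (j + 1) := by
  have h : ∑ j ∈ Finset.range (m + 1), z (j + 1) * Y (j + 1) =
      ∑ j ∈ Finset.range (m + 1), (u (j + 1) * Y (j + 1) + v j * Y (j + 1) - w j * Y (j + 1)) :=
    Finset.sum_congr rfl fun j hj => by
      rw [hs j (by simpa [Nat.lt_succ_iff] using hj)]; ring
  rw [Finset.sum_sub_distrib, Finset.sum_add_distrib] at h
  rw [Finset.sum_add_distrib, Finset.sum_range_succ, Finset.sum_range_succ',
    Finset.sum_range_succ' (fun j => u j * Y j) (m + 1),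
    Finset.sum_range_succ (fun j => v j * Y (j + 1)) (m + 1), h, h0, hl]
  ring

theorem mul_gegC_succ {lam : ℝ} (h1 : -(1 / 2) < lam) (h2 : lam ≠ 0) (n : ℕ) (x : ℝ) :
    x * gegC lam (n + 1) x = ((n + 2) * gegC lam (n + 2) x + (n + 2 * lam) * gegC lam n x) /
      (2 * (lam + (n + 1 : ℕ))) := by
  have := add_natCast_ne_zero h1 h2 (n + 1)
  rw [eq_div_iff (by simpa using this), gegC_rec h1]
  push_cast
  ring

/-- Rogers' linearization formula, for ordered degrees. -/
theorem gegC_mul_gegC_of_le {lam : ℝ} (h1 : -(1 / 2) < lam) (h2 : lam ≠ 0) (x : ℝ) (m : ℕ) :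
    ∀ n, m ≤ n → gegC lam m x * gegC lam n x =
      ∑ j ∈ Finset.range (m + 1), linCoeff lam j (m - j) (n - j) * gegC lam (m + n - 2 * j) x := by
  induction m using Nat.twoStepInduction with
  | zero =>
    intro n _
    simp [gegC_zero, linCoeff_zero_zero h1 h2]
  | one =>
    rintro (_ | n) hn
    · omega
    have e0 := linCoeff_rec_zero h1 h2 0 (n + 1)
    have e1 := linCoeff_rec_last h1 h2 0 n
    rw [linCoeff_zero_zero h1 h2] at e0 e1
    have e := mul_gegC_succ h1 h2 n x
    have hn := add_natCast_ne_zero h1 h2 (n + 1)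
    simp only [Finset.sum_range_succ, Finset.range_zero, Finset.sum_empty, gegC_one h1]
    rw [show 1 + (n + 1) - 2 * 0 = n + 2 by omega, show 1 + (n + 1) - 2 * 1 = n by omega,
      show n + 1 - 1 = n by omega]
    push_cast at *
    simp only [zero_add, one_mul, mul_one] at *
    rw [e0, e1, mul_assoc, e]
    field_simp
    ring
  | more m ih0 ih1 =>
    intro n hn
    have hm : (m + 2 : ℝ) ≠ 0 := by positivity
    refine mul_left_cancel₀ hm ?_
    rw [← mul_assoc, gegC_rec h1, sub_mul]
    have i0 := ih0 n (by omega)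
    have i1 := ih1 n (by omega)
    have key := sum_range_three_term (m := m)
      (u := fun j => (m + 1 + lam) * ((m + 1 + n - 2 * j + 1) / (lam + (m + 1 + n - 2 * j : ℕ))) *
        linCoeff lam j (m + 1 - j) (n - j))
      (v := fun j => (m + 1 + lam) * ((m + 1 + n - 2 * j - 1 + 2 * lam) /
        (lam + (m + 1 + n - 2 * j : ℕ))) * linCoeff lam j (m + 1 - j) (n - j))
      (w := fun j => (m + 2 * lam) * linCoeff lam j (m - j) (n - j))
      (z := fun j => (m + 2) * linCoeff lam j (m + 2 - j) (n - j))
      (Y := fun j => gegC lam (m + 2 + n - 2 * j) x) ?_ ?_ ?_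
    · rw [show 2 * (m + 1 + lam) * x * gegC lam (m + 1) x * gegC lam n x =
        2 * (m + 1 + lam) * (x * (gegC lam (m + 1) x * gegC lam n x)) by ring, i1,
        mul_assoc _ (gegC lam m x), i0]
      simp only [Finset.mul_sum, ← mul_assoc] at key ⊢
      rw [key]
      congr 1
      · refine Finset.sum_congr rfl fun j hj => ?_
        have hj := Finset.mem_range.1 hj
        obtain ⟨t, ht⟩ : ∃ t, m + 1 + n - 2 * j = t + 1 := ⟨m + 1 + n - 2 * j - 1, by omega⟩
        have e := mul_gegC_succ h1 h2 t x
        have hq := add_natCast_ne_zero h1 h2 (t + 1)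
        have ht' : (m + 1 + n : ℝ) - 2 * j = t + 1 := by
          have : m + 1 + n = t + 1 + 2 * j := by omega
          have : (m + 1 + n : ℝ) = t + 1 + 2 * j := by exact_mod_cast this
          linarith
        rw [ht, ht', show m + 2 + n - 2 * j = t + 2 by omega,
          show m + 2 + n - 2 * (j + 1) = t by omega]
        rw [show ∀ a b c : ℝ, a * x * b * c = a * b * (x * c) by intros; ring, e]
        field_simp
        ring
      · refine Finset.sum_congr rfl fun j hj => ?_
        rw [show m + 2 + n - 2 * (j + 1) = m + n - 2 * j by omega]
    · have := linCoeff_rec_zero h1 h2 (m + 1) n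
      simp only [Nat.sub_zero, Nat.mul_zero]
      push_cast at *
      linear_combination this
    · intro j hj
      obtain ⟨r, rfl⟩ : ∃ r, m = j + r := ⟨m - j, by omega⟩
      obtain ⟨s, rfl⟩ : ∃ s, n = j + 1 + s := ⟨n - (j + 1), by omega⟩
      have := linCoeff_rec h1 h2 j r s
      rw [show j + r + 2 - (j + 1) = r + 1 by omega, show j + 1 + s - (j + 1) = s by omega,
        show j + r + 1 + (j + 1 + s) - 2 * (j + 1) = r + s by omega,
        show j + r + 1 - (j + 1) = r by omega,
        show j + r + 1 + (j + 1 + s) - 2 * j = r + s + 2 by omega,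
        show j + r + 1 - j = r + 1 by omega, show j + 1 + s - j = s + 1 by omega,
        show j + r - j = r by omega]
      push_cast at *
      rw [show (j + r + 1 + (j + 1 + s) - 2 * (j + 1) + 1 : ℝ) = r + s + 1 by ring,
        show (j + r + 1 + (j + 1 + s) - 2 * j - 1 + 2 * lam : ℝ) = r + s + 1 + 2 * lam by ring]
      linear_combination this
    · obtain ⟨s, rfl⟩ : ∃ s, n = m + 2 + s := ⟨n - (m + 2), by omega⟩
      have := linCoeff_rec_last h1 h2 (m + 1) s
      rw [Nat.sub_self, show m + 2 + s - (m + 2) = s by omega,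
        show m + 1 + (m + 2 + s) - 2 * (m + 1) = s + 1 by omega, Nat.sub_self,
        show m + 2 + s - (m + 1) = s + 1 by omega]
      push_cast at *
      rw [show (m + 1 + (m + 2 + s) - 2 * (m + 1) - 1 + 2 * lam : ℝ) = s + 2 * lam by ring]
      linear_combination this

theorem linCoeff_comm (lam : ℝ) (j r s : ℕ) : linCoeff lam j r s = linCoeff lam j s r := by
  rw [linCoeff, linCoeff, add_comm r s, show j + r + s = j + s + r by ring]
  ring

/-- Rogers' linearization formula. -/
theorem gegC_mul_gegC {lam : ℝ} (h1 : -(1 / 2) < lam) (h2 : lam ≠ 0) (x : ℝ) (m n : ℕ) :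
    gegC lam m x * gegC lam n x =
      ∑ j ∈ Finset.range (min m n + 1),
        linCoeff lam j (m - j) (n - j) * gegC lam (m + n - 2 * j) x := by
  rcases le_total m n with h | h
  · rw [min_eq_left h, gegC_mul_gegC_of_le h1 h2 x m n h]
  · rw [min_eq_right h, mul_comm, gegC_mul_gegC_of_le h1 h2 x n m h]
    simp only [linCoeff_comm lam _ (n - _), add_comm n m]

theorem poch_neg_div {lam : ℝ} (h1 : -(1 / 2) < lam) (h2 : lam ≠ 0) {j N : ℕ} (h : j ≤ N) :
    poch (-(N : ℝ)) j / poch (-lam + 1 - N) j = pochFact lam (N - j) / pochFact lam N := by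
  have e1 := poch_reverse 1 h
  have e2 := poch_reverse lam h
  rw [poch_one, poch_one, sub_self, zero_sub] at e1
  rw [show 1 - lam - N = -lam + 1 - N by ring] at e2
  have p1 := poch_ne_zero_of_neg_half_lt h1 h2 (N - j)
  have p2 := poch_ne_zero_of_neg_half_lt h1 h2 N
  have f1 : ((N - j).factorial : ℝ) ≠ 0 := by positivity
  have f2 : (N.factorial : ℝ) ≠ 0 := by positivity
  rw [← eq_div_iff f1] at e1
  rw [← eq_div_iff p1] at e2
  have s : ((-1 : ℝ)) ^ j ≠ 0 := by positivity
  rw [e1, e2, pochFact, pochFact]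
  field_simp

theorem poch_add_div {lam : ℝ} (h1 : -(1 / 2) < lam) (h2 : lam ≠ 0) (j d : ℕ) :
    poch (lam + d) j / poch (1 + (d : ℝ)) j = pochFact lam (d + j) / pochFact lam d := by
  have p1 := poch_ne_zero_of_neg_half_lt h1 h2 d
  have f : (d.factorial : ℝ) ≠ 0 := by positivity
  rw [pochFact, pochFact, poch_add, ← poch_one (d + j), poch_add, poch_one]
  field_simp

theorem poch_neg_sub_div {lam : ℝ} (h1 : -(1 / 2) < lam) (h2 : lam ≠ 0) {j N : ℕ} (h : j ≤ N) :
    poch (-lam - N) j / poch (-2 * lam + 1 - N) j =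
      ((lam + N) * pochRatio lam N) / ((lam + (N - j : ℕ)) * pochRatio lam (N - j)) := by
  have e1 := poch_reverse (lam + 1) h
  have e2 := poch_reverse (2 * lam) h
  rw [show 1 - (lam + 1) - N = -lam - N by ring] at e1
  rw [show 1 - 2 * lam - N = -2 * lam + 1 - N by ring] at e2
  have q : ∀ i, lam * poch (lam + 1) i = poch lam i * (lam + i) := fun i => by
    rw [← poch_succ_left, poch_succ]
  have r1 := poch_ne_zero_of_neg_half_lt h1 h2 (N - j)
  have r3 := add_natCast_ne_zero h1 h2 (N - j)
  have p1 := poch_two_mul_ne_zero h1 h2 (N - j)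
  have p2 := poch_two_mul_ne_zero h1 h2 N
  have e1 : poch (-lam - N) j =
      (-1) ^ j * (poch lam N * (lam + N)) / (poch lam (N - j) * (lam + (N - j : ℕ))) := by
    rw [eq_div_iff (mul_ne_zero r1 r3), ← q, ← q]
    linear_combination lam * e1
  rw [← eq_div_iff p1] at e2
  have s : ((-1 : ℝ)) ^ j ≠ 0 := by positivity
  rw [e1, e2, pochRatio, pochRatio]
  field_simp

theorem poch_half_div {lam : ℝ} (h1 : -(1 / 2) < lam) (h2 : lam ≠ 0) {j N : ℕ} (h : 2 * j ≤ N) :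
    poch ((-lam + 2 - N) / 2) j / poch ((-lam - N) / 2) j =
      (lam + (N - 2 * j : ℕ)) / (lam + N) := by
  have hN := add_natCast_ne_zero h1 h2 N
  have hp : poch ((-lam - N) / 2) j ≠ 0 := by
    clear hN
    induction j with
    | zero => simp [poch_zero]
    | succ j ih =>
      rw [poch_succ]
      refine mul_ne_zero (ih (by omega)) fun h0 => ?_
      have : ((2 * (j + 1) : ℕ) : ℝ) ≤ N := by exact_mod_cast h
      push_cast at this
      linarith
  rw [div_eq_div_iff hp hN, Nat.cast_sub h]
  have e1 := poch_succ_left ((-lam - N) / 2) j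
  rw [poch_succ, show (-lam - N) / 2 + 1 = (-lam + 2 - N) / 2 by ring] at e1
  push_cast
  linear_combination 2 * e1

theorem poch_half_mul_div {lam : ℝ} (h1 : -(1 / 2) < lam) (h2 : lam ≠ 0) {j N : ℕ}
    (h : 2 * j ≤ N) :
    poch ((-2 * lam + 1 - N) / 2) j * poch ((-2 * lam + 2 - N) / 2) j /
        (poch (-(N : ℝ) / 2) j * poch ((1 - N) / 2) j) =
      factPochTwo lam (N - 2 * j) / factPochTwo lam N := by
  have e1 := poch_reverse 1 h
  have e2 := poch_reverse (2 * lam) h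
  rw [poch_one, poch_one, sub_self, zero_sub, poch_two_mul,
    show -(N : ℝ) + 1 = 1 - N by ring] at e1
  rw [poch_two_mul, show 1 - 2 * lam - N = -2 * lam + 1 - N by ring,
    show -2 * lam + 1 - N + 1 = -2 * lam + 2 - N by ring] at e2
  have p1 := poch_two_mul_ne_zero h1 h2 (N - 2 * j)
  have p2 := poch_two_mul_ne_zero h1 h2 N
  have f1 : ((N - 2 * j).factorial : ℝ) ≠ 0 := by positivity
  have f2 : (N.factorial : ℝ) ≠ 0 := by positivity
  have s : ((-1 : ℝ)) ^ (2 * j) ≠ 0 := by positivity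
  have t : (4 : ℝ) ^ j ≠ 0 := by positivity
  rw [← eq_div_iff f1, mul_comm, ← eq_div_iff t] at e1
  rw [← eq_div_iff p1, mul_comm, ← eq_div_iff t] at e2
  rw [e1, e2, factPochTwo, factPochTwo]
  field_simp

/-- The closed form of the terms of the hypergeometric sum, up to a constant factor. -/
noncomputable def tripleTerm (lam : ℝ) (k d m n j : ℕ) : ℝ :=
  pochFact lam j * pochFact lam (d + j) * pochFact lam (k - j) * pochFact lam (m - j) *
    pochFact lam (n - j) * pochFact lam (m + n - k - j) * factPochTwo lam (m + n - 2 * j) *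
    (lam + (m + n - 2 * j : ℕ)) /
    ((lam + (m + n - j : ℕ)) * pochRatio lam (m + n - j) *
      ((lam + (m + n + d - j : ℕ)) * pochRatio lam (m + n + d - j)))

theorem mul_ratios_eq {A B P1 P2 P3 P4 P5 P6 F1 F2 K M N L1 L5 U1 U2 U3 U4 : ℝ}
    (h1 : P1 ≠ 0) (h2 : P2 ≠ 0) (h3 : P3 ≠ 0) (h4 : P4 ≠ 0) (h5 : P5 ≠ 0) (hF : F1 ≠ 0)
    (hL : L1 ≠ 0) (hU1 : U1 ≠ 0) (hU2 : U2 ≠ 0) :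
    A * B * K * M * N * P6 * F2 * L5 / (U3 * U4) =
      P4 * P1 * P2 * P3 * P5 * F1 * L1 / (U1 * U2) *
        (A * (B / P4) * (K / P1) * (M / P2) * (N / P3) * (P6 / P5) * (U1 / U3) * (U2 / U4) *
          (L5 / L1) * (F2 / F1)) :=
  calc
    _ = A * B * K * M * N * P6 * F2 * L5 * (1 / U3) * (1 / U4) := by ring
    _ = A * (P4 * (B / P4)) * (P1 * (K / P1)) * (P2 * (M / P2)) * (P3 * (N / P3)) *
        (P5 * (P6 / P5)) * (F1 * (F2 / F1)) * (L1 * (L5 / L1)) * (1 / U1 * (U1 / U3)) *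
        (1 / U2 * (U2 / U4)) := by
      rw [mul_div_cancel₀ _ h1, mul_div_cancel₀ _ h2, mul_div_cancel₀ _ h3, mul_div_cancel₀ _ h4,
        mul_div_cancel₀ _ h5, mul_div_cancel₀ _ hF, mul_div_cancel₀ _ hL,
        div_mul_div_cancel₀ hU1, div_mul_div_cancel₀ hU2]
    _ = _ := by ring

theorem tripleTerm_eq {lam : ℝ} (h1 : -(1 / 2) < lam) (h2 : lam ≠ 0) (k d m n j : ℕ) :
    tripleTerm lam k d m n j =
      tripleTerm lam k d m n 0 *
        (pochFact lam j * (pochFact lam (d + j) / pochFact lam d) *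
          (pochFact lam (k - j) / pochFact lam k) * (pochFact lam (m - j) / pochFact lam m) *
          (pochFact lam (n - j) / pochFact lam n) *
          (pochFact lam (m + n - k - j) / pochFact lam (m + n - k)) *
          (((lam + (m + n : ℕ)) * pochRatio lam (m + n)) /
            ((lam + (m + n - j : ℕ)) * pochRatio lam (m + n - j))) *
          (((lam + (m + n + d : ℕ)) * pochRatio lam (m + n + d)) /
            ((lam + (m + n + d - j : ℕ)) * pochRatio lam (m + n + d - j))) *
          ((lam + (m + n - 2 * j : ℕ)) / (lam + (m + n : ℕ))) *
          (factPochTwo lam (m + n - 2 * j) / factPochTwo lam (m + n))) := by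
  simp only [tripleTerm, pochFact_zero, Nat.sub_zero, Nat.mul_zero, add_zero, one_mul]
  exact mul_ratios_eq (pochFact_ne_zero h1 h2 _) (pochFact_ne_zero h1 h2 _)
    (pochFact_ne_zero h1 h2 _) (pochFact_ne_zero h1 h2 _) (pochFact_ne_zero h1 h2 _)
    (factPochTwo_ne_zero h1 h2 _) (add_natCast_ne_zero h1 h2 _)
    (mul_ne_zero (add_natCast_ne_zero h1 h2 _) (pochRatio_ne_zero h1 h2 _))
    (mul_ne_zero (add_natCast_ne_zero h1 h2 _) (pochRatio_ne_zero h1 h2 _))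

theorem hypSum_mul_tripleTerm {lam : ℝ} (h1 : -(1 / 2) < lam) (h2 : lam ≠ 0) {k m n : ℕ} (d : ℕ)
    (hk : k ≤ m + n) :
    tripleTerm lam k d m n 0 *
    hypSum
      [lam, lam + d, -(k : ℝ), -(m : ℝ), -(n : ℝ), -((m + n - k : ℕ) : ℝ),
        -lam - (m + n : ℕ), -lam - (m + n + d : ℕ), (-lam + 2 - (m + n : ℕ)) / 2,
        (-2 * lam + 1 - (m + n : ℕ)) / 2, (-2 * lam + 2 - (m + n : ℕ)) / 2]
      [1 + (d : ℝ), -lam + 1 - k, -lam + 1 - m, -lam + 1 - n, -lam + 1 - (m + n - k : ℕ),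
        -2 * lam + 1 - (m + n : ℕ), -2 * lam + 1 - (m + n + d : ℕ), (-lam - (m + n : ℕ)) / 2,
        -((m + n : ℕ) : ℝ) / 2, (1 - (m + n : ℕ)) / 2] 1 =
    ∑ j ∈ Finset.range (min (min k (m + n - k)) (min m n) + 1), tripleTerm lam k d m n j := by
  rw [hypSum, tsum_eq_sum (s := Finset.range (min (min k (m + n - k)) (min m n) + 1)),
    Finset.mul_sum]
  · refine Finset.sum_congr rfl fun j hj => ?_
    rw [Finset.mem_range, Nat.lt_succ_iff, le_min_iff, le_min_iff, le_min_iff] at hj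
    obtain ⟨⟨hj1, hj2⟩, hj3, hj4⟩ := hj
    simp only [List.map_cons, List.map_nil, List.prod_cons, List.prod_nil, one_pow, mul_one]
    have r1 := poch_neg_div h1 h2 hj1
    have r2 := poch_neg_div h1 h2 hj2
    have r3 := poch_neg_div h1 h2 hj3
    have r4 := poch_neg_div h1 h2 hj4
    have r5 := poch_add_div h1 h2 j d
    have r6 := poch_neg_sub_div h1 h2 (show j ≤ m + n by omega)
    have r7 := poch_neg_sub_div h1 h2 (show j ≤ m + n + d by omega)
    have r8 := poch_half_div h1 h2 (show 2 * j ≤ m + n by omega)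
    have r9 := poch_half_mul_div h1 h2 (show 2 * j ≤ m + n by omega)
    rw [tripleTerm_eq h1 h2 k d m n j, ← r1, ← r2, ← r3, ← r4, ← r5, ← r6, ← r7, ← r8, ← r9,
      show pochFact lam j = poch lam j / j.factorial from rfl]
    congr 1
    ring
  · intro j hj
    rw [Finset.mem_range, Nat.lt_succ_iff, le_min_iff, le_min_iff, le_min_iff] at hj
    have : k < j ∨ m + n - k < j ∨ m < j ∨ n < j := by omega
    rcases this with h | h | h | h <;> simp [poch_neg_eq_zero h]

theorem pochZ_natCast (a : ℝ) (n : ℕ) : pochZ a n = poch a n := by simp [pochZ]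

theorem ifact_natCast (n : ℕ) : ifact n = n.factorial := by simp [ifact]

theorem hypSum_congr_perm {a a' b b' : List ℝ} (ha : a.Perm a') (hb : b.Perm b') (z : ℝ) :
    hypSum a b z = hypSum a' b' z := by
  simp only [hypSum, (ha.map _).prod_eq, (hb.map _).prod_eq]

theorem tripleTerm_zero {lam : ℝ} (h1 : -(1 / 2) < lam) (h2 : lam ≠ 0) (k d m n : ℕ) :
    tripleTerm lam k d m n 0 =
      pochFact lam d * pochFact lam k * pochFact lam m * pochFact lam n *
        pochFact lam (m + n - k) * ((m + n).factorial / poch lam (m + n)) /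
          ((lam + (m + n + d : ℕ)) * pochRatio lam (m + n + d)) := by
  have e : factPochTwo lam (m + n) * (lam + (m + n : ℕ)) /
      ((lam + (m + n : ℕ)) * pochRatio lam (m + n)) =
      (m + n).factorial / poch lam (m + n) := by
    have := poch_ne_zero_of_neg_half_lt h1 h2 (m + n)
    have := poch_two_mul_ne_zero h1 h2 (m + n)
    have := add_natCast_ne_zero h1 h2 (m + n)
    rw [factPochTwo, pochRatio]
    field_simp
  rw [← e]
  simp only [tripleTerm, pochFact_zero, Nat.sub_zero, Nat.mul_zero, add_zero, div_eq_mul_inv,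
    mul_inv]
  ring

theorem linCoeff_mul_linCoeff (lam : ℝ) {k m n j : ℕ} (d : ℕ) (hk : j ≤ k) (hm : j ≤ m)
    (hn : j ≤ n) (hkj : k + j ≤ m + n) :
    linCoeff lam j (m - j) (n - j) * linCoeff lam (k - j) (d + j) (m + n - k - j) =
      (lam + (m + n + d - k : ℕ)) * factPochTwo lam (m + n + d - k) * tripleTerm lam k d m n j := by
  rw [linCoeff, linCoeff, tripleTerm, show j + (m - j) + (n - j) = m + n - j by omega,
    show m - j + (n - j) = m + n - 2 * j by omega,
    show d + j + (m + n - k - j) = m + n + d - k by omega,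
    show k - j + (d + j) + (m + n - k - j) = m + n + d - j by omega]
  simp only [div_eq_mul_inv, mul_inv]
  ring

theorem linCoeff_add_mul_linCoeff (lam : ℝ) {k m n j : ℕ} (d : ℕ) (hk : j ≤ k) (hm : j ≤ m)
    (hn : j ≤ n) (hkj : k + j ≤ m + n) :
    linCoeff lam (d + j) (m - j) (n - j) * linCoeff lam (k - j) j (m + n - k - j) =
      (lam + (m + n - k : ℕ)) * factPochTwo lam (m + n - k) * tripleTerm lam k d m n j := by
  rw [linCoeff, linCoeff, tripleTerm, show d + j + (m - j) + (n - j) = m + n + d - j by omega,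
    show m - j + (n - j) = m + n - 2 * j by omega,
    show j + (m + n - k - j) = m + n - k by omega,
    show k - j + j + (m + n - k - j) = m + n - j by omega]
  simp only [div_eq_mul_inv, mul_inv]
  ring

theorem gegD_eq_sum {lam : ℝ} (h1 : -(1 / 2) < lam) (h2 : lam ≠ 0) {k m n : ℕ} (d : ℕ)
    (hk : k ≤ m + n) :
    gegD lam k (k + d : ℕ) m n =
      ∑ j ∈ Finset.range (min (min k (m + n - k)) (min m n) + 1),
        linCoeff lam j (m - j) (n - j) * linCoeff lam (k - j) (d + j) (m + n - k - j) := by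
  trans (lam + (m + n + d - k : ℕ)) * factPochTwo lam (m + n + d - k) *
    ∑ j ∈ Finset.range (min (min k (m + n - k)) (min m n) + 1), tripleTerm lam k d m n j
  · rw [← hypSum_mul_tripleTerm h1 h2 d hk, ← mul_assoc, gegD]
    refine congrArg₂ (· * ·) ?_ (congrArg₂ (fun a b => hypSum a b 1) ?_ ?_)
    · rw [show (m : ℤ) + n + (k + d : ℕ) - 2 * k = (m + n + d - k : ℕ) by omega,
        show (m : ℤ) + n + (k + d : ℕ) - k = (m + n + d : ℕ) by omega,
        show (m : ℤ) + n - k = (m + n - k : ℕ) by omega,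
        show ((k + d : ℕ) : ℤ) - k = d by omega,
        show (m : ℤ) + n = (m + n : ℕ) by omega,
        show lam + ((m : ℤ) : ℝ) + (n : ℤ) + ((k + d : ℕ) : ℤ) - 2 * (k : ℤ) =
          lam + (m + n + d - k : ℕ) by
            rw [Nat.cast_sub (by omega)]; push_cast; ring,
        show lam + ((m : ℤ) : ℝ) + (n : ℤ) + ((k + d : ℕ) : ℤ) - (k : ℤ) =
          lam + (m + n + d : ℕ) by push_cast; ring, tripleTerm_zero h1 h2]
      simp only [pochZ_natCast, ifact_natCast, pochFact, factPochTwo, pochRatio,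
        div_eq_mul_inv, mul_inv, inv_inv]
      ring
    all_goals
      simp only [List.cons.injEq, and_true, true_and]
      push_cast [Nat.cast_sub hk]
      (repeat' apply And.intro) <;> ring
  · rw [Finset.mul_sum]
    refine Finset.sum_congr rfl fun j hj => ?_
    rw [Finset.mem_range] at hj
    exact (linCoeff_mul_linCoeff lam d (by omega) (by omega) (by omega) (by omega)).symm

theorem gegE_eq_sum {lam : ℝ} (h1 : -(1 / 2) < lam) (h2 : lam ≠ 0) {p m n : ℕ} (d : ℕ)
    (hp : p ≤ m + n) :
    gegE lam (p + d : ℕ) p (m + d : ℕ) (n + d : ℕ) =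
      ∑ j ∈ Finset.range (min (min p (m + n - p)) (min m n) + 1),
        linCoeff lam (d + j) (m - j) (n - j) * linCoeff lam (p - j) j (m + n - p - j) := by
  trans (lam + (m + n - p : ℕ)) * factPochTwo lam (m + n - p) *
    ∑ j ∈ Finset.range (min (min p (m + n - p)) (min m n) + 1), tripleTerm lam p d m n j
  · rw [← hypSum_mul_tripleTerm h1 h2 d hp, ← mul_assoc, gegE]
    refine congrArg₂ (· * ·) ?_ ?_
    · rw [show ((m + d : ℕ) : ℤ) + (n + d : ℕ) + p - 2 * (p + d : ℕ) = (m + n - p : ℕ) by omega,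
        show ((m + d : ℕ) : ℤ) + (n + d : ℕ) + 2 * p - 2 * (p + d : ℕ) = (m + n : ℕ) by omega,
        show ((m + d : ℕ) : ℤ) + (n + d : ℕ) + p - (p + d : ℕ) = (m + n + d : ℕ) by omega,
        show ((m + d : ℕ) : ℤ) + p - (p + d : ℕ) = m by omega,
        show ((n + d : ℕ) : ℤ) + p - (p + d : ℕ) = n by omega,
        show ((p + d : ℕ) : ℤ) - p = d by omega,
        show lam + (((m + d : ℕ) : ℤ) : ℝ) + ((n + d : ℕ) : ℤ) + (p : ℤ) -
          2 * ((p + d : ℕ) : ℤ) = lam + (m + n - p : ℕ) by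
            rw [Nat.cast_sub hp]; push_cast; ring,
        show lam + (((m + d : ℕ) : ℤ) : ℝ) + ((n + d : ℕ) : ℤ) + (p : ℤ) -
          ((p + d : ℕ) : ℤ) = lam + (m + n + d : ℕ) by push_cast; ring, tripleTerm_zero h1 h2]
      simp only [pochZ_natCast, ifact_natCast]
      trans (lam + (m + n - p : ℕ)) *
        ((m + n - p).factorial * (1 / (m + n - p).factorial) / poch (2 * lam) (m + n - p)) *
        (pochFact lam d * pochFact lam p * pochFact lam m * pochFact lam n *
        poch lam (m + n - p) * ((m + n).factorial / poch lam (m + n)) /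
          ((lam + (m + n + d : ℕ)) * pochRatio lam (m + n + d)))
      · rw [mul_one_div_cancel (by positivity)]
        simp only [pochFact, pochRatio, div_eq_mul_inv, mul_inv, inv_inv]
        ring
      · rw [factPochTwo, pochFact.eq_1 lam (m + n - p)]
        ring
    · rw [hypSum_congr_perm
        (((((((List.Perm.swap _ _ _).cons _).cons _).cons _).cons _).cons _).cons _)
        (((((List.Perm.swap _ _ _).cons _).cons _).cons _).cons _ |>.cons _)]
      refine congrArg₂ (fun a b => hypSum a b 1) ?_ ?_
      all_goals
        simp only [List.cons.injEq, and_true, true_and]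
        push_cast [Nat.cast_sub hp]
        (repeat' apply And.intro) <;> ring
  · rw [Finset.mul_sum]
    refine Finset.sum_congr rfl fun j hj => ?_
    rw [Finset.mem_range] at hj
    exact (linCoeff_add_mul_linCoeff lam d (by omega) (by omega) (by omega) (by omega)).symm

theorem gegE_eq_zero (lam : ℝ) {k p m n : ℤ} (h : m + p - k < 0) : gegE lam k p m n = 0 := by
  rw [gegE, ifact.eq_1 (m + p - k), if_neg (not_le.2 h)]
  simp only [mul_zero, zero_mul, div_zero]

theorem gegF_eq_sum {lam : ℝ} (h1 : -(1 / 2) < lam) (h2 : lam ≠ 0) {k p m n : ℕ} (hpm : p ≤ m)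
    (hmn : m ≤ n) (hk : k ≤ (p + m + n) / 2) :
    gegF lam k p m n =
      ∑ j ∈ Finset.range (m + 1) with j ≤ k ∧ k ≤ p + j ∧ k + j ≤ m + n,
        linCoeff lam j (m - j) (n - j) * linCoeff lam (k - j) (p - (k - j)) (m + n - k - j) := by
  rcases lt_or_ge k p with h | h
  · obtain ⟨d, rfl⟩ := Nat.exists_eq_add_of_le h.le
    rw [gegF, if_pos (by omega), gegD_eq_sum h1 h2 d (by omega)]
    refine Finset.sum_congr ?_ fun j hj => ?_
    · ext j
      simp only [Finset.mem_range, Finset.mem_filter]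
      omega
    · rw [Finset.mem_filter] at hj
      rw [show k + d - (k - j) = d + j by omega]
  · rw [gegF, if_neg (by omega), if_pos ⟨by omega, by
      rw [Int.fdiv_eq_ediv_of_nonneg _ (by norm_num)]; omega⟩]
    obtain ⟨d, rfl⟩ := Nat.exists_eq_add_of_le h
    rcases lt_or_ge m d with hd | hd
    · rw [gegE_eq_zero lam (by omega), Finset.sum_eq_zero]
      intro j hj
      rw [Finset.mem_filter, Finset.mem_range] at hj
      omega
    · obtain ⟨m, rfl⟩ := Nat.exists_eq_add_of_le' hd
      obtain ⟨n, rfl⟩ := Nat.exists_eq_add_of_le' (hd.trans hmn)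
      rw [gegE_eq_sum h1 h2 d (by omega)]
      refine Finset.sum_nbij' (fun j => d + j) (fun j => j - d) ?_ ?_ ?_ ?_ ?_
      · intro j hj
        simp only [Finset.mem_range, Finset.mem_filter] at hj ⊢
        omega
      · intro j hj
        simp only [Finset.mem_range, Finset.mem_filter] at hj ⊢
        omega
      · intro j _
        simp
      · intro j hj
        simp only [Finset.mem_filter] at hj
        omega
      · intro j hj
        rw [Finset.mem_range] at hj
        rw [show m + d - (d + j) = m - j by omega, show n + d - (d + j) = n - j by omega,
          show p + d - (d + j) = p - j by omega, show p - (p - j) = j by omega,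
          show m + d + (n + d) - (p + d) - (d + j) = m + n - p - j by omega]

theorem stmt2 (p m n : ℕ) (hpm : p ≤ m) (hmn : m ≤ n)
    (lam : ℝ) (h1 : -(1 / 2) < lam) (h2 : lam ≠ 0) (x : ℝ) :
    gegC lam p x * gegC lam m x * gegC lam n x =
      ∑ k ∈ Finset.range ((p + m + n) / 2 + 1),
        gegF lam (k : ℤ) (p : ℤ) (m : ℤ) (n : ℤ) * gegC lam (p + m + n - 2 * k) x := by

  rw [mul_assoc, gegC_mul_gegC_of_le h1 h2 x m n hmn, Finset.mul_sum]
  trans ∑ j ∈ Finset.range (m + 1), ∑ i ∈ Finset.range (min p (m + n - 2 * j) + 1),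
    linCoeff lam j (m - j) (n - j) * (linCoeff lam i (p - i) (m + n - 2 * j - i) *
      gegC lam (p + (m + n - 2 * j) - 2 * i) x)
  · refine Finset.sum_congr rfl fun j _ => ?_
    rw [mul_left_comm, gegC_mul_gegC h1 h2, Finset.mul_sum]
  trans ∑ k ∈ Finset.range ((p + m + n) / 2 + 1),
    ∑ j ∈ Finset.range (m + 1) with j ≤ k ∧ k ≤ p + j ∧ k + j ≤ m + n,
      linCoeff lam j (m - j) (n - j) * linCoeff lam (k - j) (p - (k - j)) (m + n - k - j) *
        gegC lam (p + m + n - 2 * k) x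
  · rw [Finset.sum_sigma', Finset.sum_sigma']
    refine Finset.sum_nbij' (fun a => ⟨a.1 + a.2, a.1⟩) (fun a => ⟨a.2, a.1 - a.2⟩) ?_ ?_ ?_ ?_ ?_
    · rintro ⟨j, i⟩ h
      simp only [Finset.mem_sigma, Finset.mem_filter, Finset.mem_range] at h ⊢
      omega
    · rintro ⟨k, j⟩ h
      simp only [Finset.mem_sigma, Finset.mem_filter, Finset.mem_range] at h ⊢
      omega
    · rintro ⟨j, i⟩ _
      simp
    · rintro ⟨k, j⟩ h
      simp only [Finset.mem_sigma, Finset.mem_filter] at h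
      simp only [Sigma.mk.injEq, heq_eq_eq, and_true]
      omega
    · rintro ⟨j, i⟩ h
      simp only [Finset.mem_sigma, Finset.mem_range] at h
      simp only [Nat.add_sub_cancel_left]
      rw [show m + n - (j + i) - j = m + n - 2 * j - i by omega,
        show p + (m + n - 2 * j) - 2 * i = p + m + n - 2 * (j + i) by omega, mul_assoc]
  · refine Finset.sum_congr rfl fun k hk => ?_
    rw [gegF_eq_sum h1 h2 hpm hmn (by simpa [Nat.lt_succ_iff] using hk), Finset.sum_mul]
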